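/- arXiv:1605.07129 — 2 statements merged into one kernel-verified Lean document; each statement's English description precedes it below -/
import Mathlib

section
/- Let A ∈ ℂ^{d×d} be a self-adjoint matrix. Then the matrix I + A + A²/2 is positive definite, and moreover −log(I + A + A²/2) ⪯ log(I − A + A²/2), where log is applied to positive definite matrices via the matrix functional calculus and ⪯ denotes the Loewner order (B ⪯ C iff C − B is positive semidefinite). -/
set_option autoImplicit false

open MeasureTheory ProbabilityTheory Matrix
open scoped ENNReal

noncomputable section

instance matMeasurableSpace {m n α : Type*} [MeasurableSpace α] :
    MeasurableSpace (Matrix m n α) :=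
  (inferInstance : MeasurableSpace (m → n → α))

/-- Entrywise expectation of a random matrix. -/
def matExp {Ω : Type*} [MeasurableSpace Ω] {𝕜 : Type*} [RCLike 𝕜] {m n : Type*}
    (μ : Measure Ω) (Y : Ω → Matrix m n 𝕜) : Matrix m n 𝕜 :=
  Matrix.of fun i j => ∫ ω, Y ω i j ∂μ

/-- Operator (spectral) norm of a matrix, i.e. the norm of the associated linear map
between Euclidean spaces. -/
def opNorm {𝕜 : Type*} [RCLike 𝕜] {m n : Type*} [Fintype m] [Fintype n] [DecidableEq n]
    (A : Matrix m n 𝕜) : ℝ :=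
  ‖LinearMap.toContinuousLinearMap (Matrix.toEuclideanLin A)‖

/-- Matrix functional calculus: apply `f : ℝ → ℝ` to the eigenvalues of a self-adjoint
matrix (junk value `0` if the matrix is not self-adjoint). -/
def matFun {𝕜 : Type*} [RCLike 𝕜] {d : Type*} [Fintype d] [DecidableEq d]
    (f : ℝ → ℝ) (A : Matrix d d 𝕜) : Matrix d d 𝕜 :=
  if h : A.IsHermitian then
    (h.eigenvectorUnitary : Matrix d d 𝕜) *
      Matrix.diagonal (fun i => (f (h.eigenvalues i) : 𝕜)) *
      star (h.eigenvectorUnitary : Matrix d d 𝕜)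
  else 0

open scoped ComplexOrder

open scoped MatrixOrder

section

variable {𝕜 : Type*} [RCLike 𝕜] {d : Type*} [Fintype d] [DecidableEq d] {A : Matrix d d 𝕜}

theorem matFun_eq_cfc (hA : A.IsHermitian) (f : ℝ → ℝ) : matFun f A = cfc f A := by
  rw [hA.cfc_eq, matFun, dif_pos hA]
  rfl

theorem matFun_cfc {f g : ℝ → ℝ} (hA : A.IsHermitian) : matFun g (cfc f A) = cfc (g ∘ f) A := by
  have hfin := A.finite_real_spectrum
  rw [matFun_eq_cfc (cfc_predicate f A), cfc_comp g f A hA.isSelfAdjoint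
    ((hfin.image f).continuousOn g) (hfin.continuousOn f)]

theorem posDef_cfc {f : ℝ → ℝ} (hA : A.IsHermitian) (hf : ∀ x, 0 < f x) : (cfc f A).PosDef := by
  rw [hA.cfc_eq, IsHermitian.cfc, Unitary.conjStarAlgAut_apply]
  refine (IsUnit.posDef_star_right_conjugate_iff
    (Unitary.isUnit_coe (U := hA.eigenvectorUnitary))).2 (posDef_diagonal_iff.2 fun i => ?_)
  simpa using hf _

end

theorem one_add_add_sq_eq_cfc {d : Type*} [Fintype d] [DecidableEq d] {A : Matrix d d ℂ}
    (hA : A.IsHermitian) :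
    1 + A + (2 : ℂ)⁻¹ • A ^ 2 = cfc (fun x : ℝ => 1 + x + 2⁻¹ * x ^ 2) A := by
  have := hA.isSelfAdjoint
  rw [cfc_add (a := A) (fun x : ℝ => 1 + x) (fun x : ℝ => 2⁻¹ * x ^ 2),
    cfc_const_add 1 (fun x : ℝ => x) A, cfc_const_mul (2⁻¹ : ℝ) (fun x : ℝ => x ^ 2),
    cfc_pow_id (R := ℝ) A 2, cfc_id' ℝ A, map_one]
  congr 1
  ext i j
  simp

theorem one_add_add_sq_pos (x : ℝ) : 0 < 1 + x + 2⁻¹ * x ^ 2 := by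
  nlinarith [sq_nonneg (1 + x)]

theorem log_one_sub_add_log_one_add_nonneg (x : ℝ) :
    0 ≤ Real.log (1 + -x + 2⁻¹ * (-x) ^ 2) + Real.log (1 + x + 2⁻¹ * x ^ 2) := by
  rw [← Real.log_mul (one_add_add_sq_pos _).ne' (one_add_add_sq_pos _).ne']
  apply Real.log_nonneg
  nlinarith [sq_nonneg (x ^ 2)]

/-- Fact 4: for self-adjoint `A`, the matrix `I + A + A²/2` is positive definite, and
`−log(I + A + A²/2) ⪯ log(I − A + A²/2)` in the Loewner order. -/
theorem statement0 {d : ℕ} (A : Matrix (Fin d) (Fin d) ℂ) (hA : A.IsHermitian) :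
    (1 + A + (2 : ℂ)⁻¹ • A ^ 2).PosDef ∧
      (matFun Real.log (1 - A + (2 : ℂ)⁻¹ • A ^ 2) +
        matFun Real.log (1 + A + (2 : ℂ)⁻¹ • A ^ 2)).PosSemidef := by
  have hcont (f : ℝ → ℝ) : ContinuousOn f (spectrum ℝ A) := A.finite_real_spectrum.continuousOn f
  have hsub : 1 - A + (2 : ℂ)⁻¹ • A ^ 2 = cfc (fun x : ℝ => 1 + -x + 2⁻¹ * (-x) ^ 2) A := by
    rw [cfc_comp_neg (fun x : ℝ => 1 + x + 2⁻¹ * x ^ 2) A (by fun_prop) hA.isSelfAdjoint,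
      ← one_add_add_sq_eq_cfc hA.neg, neg_sq, sub_eq_add_neg]
  rw [hsub, one_add_add_sq_eq_cfc hA, matFun_cfc hA, matFun_cfc hA,
    ← cfc_add (a := A) _ _ (hcont _) (hcont _)]
  exact ⟨posDef_cfc hA one_add_add_sq_pos, nonneg_iff_posSemidef.1 <|
    cfc_nonneg fun x _ => log_one_sub_add_log_one_add_nonneg x⟩
end
end

section
/- Let 1 < α ≤ 2 and c_α = max( (α−1)/α , √((2−α)/α) ). Then for every y ∈ ℝ, 1 + y + c_α|y|^α > 0 and −log(1 + y + c_α|y|^α) ≤ log(1 − y + c_α|y|^α). -/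
set_option autoImplicit false

/-- Young's inequality interpolating `x ^ 2` between `x ^ α` and `(x ^ α) ^ 2`. -/
lemma sq_le_rpow_add_rpow_sq {α x : ℝ} (hα₁ : 1 < α) (hα₂ : α ≤ 2) (hx : 0 ≤ x) :
    x ^ 2 ≤ 2 * ((α - 1) / α) * x ^ α + (2 - α) / α * (x ^ α) ^ 2 := by
  have hα : 0 < α := by linarith
  have hw₁ : 0 ≤ 2 * ((α - 1) / α) := mul_nonneg zero_le_two (div_nonneg (by linarith) hα.le)
  have hw₂ : 0 ≤ (2 - α) / α := div_nonneg (by linarith) hα.le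
  have h := Real.geom_mean_le_arith_mean2_weighted hw₁ hw₂ (Real.rpow_nonneg hx α)
    (sq_nonneg (x ^ α)) (by field_simp; ring)
  refine le_of_eq_of_le ?_ h
  rw [← Real.rpow_natCast (x ^ α) 2, ← Real.rpow_mul hx, ← Real.rpow_mul hx, ← Real.rpow_mul hx,
    ← Real.rpow_add_of_nonneg hx (mul_nonneg hα.le hw₁)
      (mul_nonneg (mul_nonneg hα.le (Nat.cast_nonneg 2)) hw₂), ← Real.rpow_natCast x 2]
  congr 1
  push_cast
  field_simp
  ring

/-- Lemma A.2: for `1 < α ≤ 2` and `c_α = max((α−1)/α, √((2−α)/α))`, one has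
`1 + y + c_α|y|^α > 0` and `−log(1 + y + c_α|y|^α) ≤ log(1 − y + c_α|y|^α)` for all `y`. -/
theorem statement7 (α : ℝ) (hα₁ : 1 < α) (hα₂ : α ≤ 2) (y : ℝ) :
    0 < 1 + y + max ((α - 1) / α) (Real.sqrt ((2 - α) / α)) * |y| ^ α ∧
      -Real.log (1 + y + max ((α - 1) / α) (Real.sqrt ((2 - α) / α)) * |y| ^ α)
        ≤ Real.log (1 - y + max ((α - 1) / α) (Real.sqrt ((2 - α) / α)) * |y| ^ α) := by
  have h := sq_le_rpow_add_rpow_sq hα₁ hα₂ (abs_nonneg y)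
  rw [sq_abs] at h
  have hc₁ := le_max_left ((α - 1) / α) (Real.sqrt ((2 - α) / α))
  have hc₂ := le_max_right ((α - 1) / α) (Real.sqrt ((2 - α) / α))
  set c := max ((α - 1) / α) (Real.sqrt ((2 - α) / α))
  have hc : 0 ≤ c := (Real.sqrt_nonneg _).trans hc₂
  have hc_sq : (2 - α) / α ≤ c ^ 2 := (Real.sqrt_le_left hc).mp hc₂
  have hr : 0 ≤ |y| ^ α := Real.rpow_nonneg (abs_nonneg y) α
  set r := |y| ^ α
  have hcr : 0 ≤ c * r := mul_nonneg hc hr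
  have hprod : 1 ≤ (1 + y + c * r) * (1 - y + c * r) := by
    nlinarith [mul_le_mul_of_nonneg_right hc₁ hr, mul_le_mul_of_nonneg_right hc_sq (sq_nonneg r)]
  have hpos : 0 < 1 + y + c * r ∧ 0 < 1 - y + c * r := by
    rcases mul_pos_iff.mp (zero_lt_one.trans_le hprod) with hp | hn
    · exact hp
    · linarith [hn.1, hn.2]
  refine ⟨hpos.1, ?_⟩
  have hlog := Real.log_nonneg hprod
  rw [Real.log_mul hpos.1.ne' hpos.2.ne'] at hlog
  linarith
end
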